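/- arXiv:0901.0207 — 2 statements merged into one kernel-verified Lean document; each statement's English description precedes it below -/
import Mathlib

section
/- Suppose Π(A₂) = 0, Π(A₃) > 0 and θ₁ ≤ θ₃. Then L*(Π) = {u ∈ ℝ : θ₁ ≤ u and u ≤ θ₃} (the inequalities being taken in the extended reals). In particular L*(Π) ⊆ (−∞, 0]. (Measure-theoretic form of case (b) of Proposition 'endpoints of L star' (5).) -/
open MeasureTheory Set Filter

noncomputable section

/-- The region below the curve `y = u (e^{-x} - 1)`: jumps causing a negative jump of the GOU. -/
def Cneg (u : ℝ) : Set (ℝ × ℝ) := {p | p.2 - u * (Real.exp (-p.1) - 1) < 0}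

/-- The region above the curve `y = u (e^{-x} - 1)`: jumps causing a positive jump of the GOU. -/
def Cpos (u : ℝ) : Set (ℝ × ℝ) := {p | 0 < p.2 - u * (Real.exp (-p.1) - 1)}

/-- Set of starting values at which the GOU process has no negative jumps. -/
def Lstar (mu : Measure (ℝ × ℝ)) : Set ℝ := {u | mu (Cneg u) = 0}

/-- Set of starting values at which the GOU process has no positive jumps. -/
def Ustar (mu : Measure (ℝ × ℝ)) : Set ℝ := {u | mu (Cpos u) = 0}

def A1 : Set (ℝ × ℝ) := {p | 0 ≤ p.1 ∧ 0 ≤ p.2}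
def A2 : Set (ℝ × ℝ) := {p | 0 ≤ p.1 ∧ p.2 ≤ 0}
def A3 : Set (ℝ × ℝ) := {p | p.1 ≤ 0 ∧ p.2 ≤ 0}
def A4 : Set (ℝ × ℝ) := {p | p.1 ≤ 0 ∧ 0 ≤ p.2}

noncomputable def theta1 (mu : Measure (ℝ × ℝ)) : EReal :=
  if 0 < mu (A1 \ A4) then
    sSup ((fun v : ℝ => (v : EReal)) '' {v | v ≤ 0 ∧ 0 < mu (A1 ∩ Cneg v)}) else ⊥

noncomputable def theta2 (mu : Measure (ℝ × ℝ)) : EReal :=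
  if 0 < mu (A2 \ A1) then
    sSup ((fun v : ℝ => (v : EReal)) '' {v | 0 ≤ v ∧ 0 < mu (A2 ∩ Cneg v)}) else 0

noncomputable def theta3 (mu : Measure (ℝ × ℝ)) : EReal :=
  if 0 < mu (A3 \ A4) then
    sInf ((fun v : ℝ => (v : EReal)) '' {v | v ≤ 0 ∧ 0 < mu (A3 ∩ Cneg v)}) else 0

noncomputable def theta4 (mu : Measure (ℝ × ℝ)) : EReal :=
  if 0 < mu (A4 \ A1) then
    sInf ((fun v : ℝ => (v : EReal)) '' {v | 0 ≤ v ∧ 0 < mu (A4 ∩ Cneg v)}) else ⊤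

noncomputable def theta1' (mu : Measure (ℝ × ℝ)) : EReal :=
  if 0 < mu (A1 \ A2) then
    sInf ((fun v : ℝ => (v : EReal)) '' {v | v ≤ 0 ∧ 0 < mu (A1 ∩ Cpos v)}) else 0

noncomputable def theta2' (mu : Measure (ℝ × ℝ)) : EReal :=
  if 0 < mu (A2 \ A3) then
    sInf ((fun v : ℝ => (v : EReal)) '' {v | 0 ≤ v ∧ 0 < mu (A2 ∩ Cpos v)}) else ⊤

noncomputable def theta3' (mu : Measure (ℝ × ℝ)) : EReal :=
  if 0 < mu (A3 \ A2) then
    sSup ((fun v : ℝ => (v : EReal)) '' {v | v ≤ 0 ∧ 0 < mu (A3 ∩ Cpos v)}) else ⊥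

noncomputable def theta4' (mu : Measure (ℝ × ℝ)) : EReal :=
  if 0 < mu (A4 \ A3) then
    sSup ((fun v : ℝ => (v : EReal)) '' {v | 0 ≤ v ∧ 0 < mu (A4 ∩ Cpos v)}) else 0

/-- A sequential form of lower semicontinuity of `u ↦ mu (A ∩ Cneg u)`. -/
theorem exists_measure_inter_Cneg_pos {mu : Measure (ℝ × ℝ)} {A : Set (ℝ × ℝ)} {u : ℝ}
    {w : ℕ → ℝ} (hw : Tendsto w atTop (nhds u)) (hu : 0 < mu (A ∩ Cneg u)) :
    ∃ n, 0 < mu (A ∩ Cneg (w n)) := by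
  by_contra! h
  refine hu.ne' (measure_mono_null ?_ (measure_iUnion_null fun n => le_zero_iff.1 (h n)))
  rintro p ⟨hpA, hp⟩
  have hlim : Tendsto (fun n => p.2 - w n * (Real.exp (-p.1) - 1)) atTop
      (nhds (p.2 - u * (Real.exp (-p.1) - 1))) :=
    tendsto_const_nhds.sub (hw.mul_const _)
  obtain ⟨n, hn⟩ := (hlim.eventually (gt_mem_nhds hp)).exists
  exact mem_iUnion.2 ⟨n, hpA, hn⟩

theorem A1_inter_Cneg_antitone : Antitone fun u => A1 ∩ Cneg u := by
  rintro u v huv p ⟨hpA, hp⟩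
  have he : Real.exp (-p.1) ≤ 1 := Real.exp_le_one_iff.2 (by linarith [hpA.1])
  refine ⟨hpA, ?_⟩
  simp only [Cneg, mem_ofPred_eq] at hp ⊢
  nlinarith

theorem A3_inter_Cneg_monotone : Monotone fun u => A3 ∩ Cneg u := by
  rintro u v huv p ⟨hpA, hp⟩
  have he : 1 ≤ Real.exp (-p.1) := Real.one_le_exp (by linarith [hpA.1])
  refine ⟨hpA, ?_⟩
  simp only [Cneg, mem_ofPred_eq] at hp ⊢
  nlinarith

theorem A1_inter_Cneg_subset {u : ℝ} : A1 ∩ Cneg u ⊆ A1 \ A4 := by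
  rintro p ⟨hpA, hp⟩
  refine ⟨hpA, fun hp4 => ?_⟩
  have hx : p.1 = 0 := le_antisymm hp4.1 hpA.1
  simp only [Cneg, mem_ofPred_eq, hx, neg_zero, Real.exp_zero, sub_self, mul_zero, sub_zero] at hp
  exact hp.not_ge hpA.2

theorem A4_inter_Cneg_eq_empty {u : ℝ} (hu : u ≤ 0) : A4 ∩ Cneg u = ∅ := by
  refine eq_empty_of_forall_notMem ?_
  rintro p ⟨hpA, hp⟩
  have he : 1 ≤ Real.exp (-p.1) := Real.one_le_exp (by linarith [hpA.1])
  have hy := hpA.2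
  simp only [Cneg, mem_ofPred_eq] at hp
  nlinarith

theorem A3_inter_Cneg_subset {u : ℝ} (hu : u ≤ 0) : A3 ∩ Cneg u ⊆ A3 \ A4 := by
  rintro p ⟨hpA, hp⟩
  refine ⟨hpA, fun hp4 => ?_⟩
  have h : p ∈ A4 ∩ Cneg u := ⟨hp4, hp⟩
  rwa [A4_inter_Cneg_eq_empty hu] at h

theorem A3_diff_A4_subset : A3 \ A4 ⊆ A3 ∩ Cneg 0 := by
  rintro p ⟨hp3, hp4⟩
  refine ⟨hp3, ?_⟩
  simp only [Cneg, mem_ofPred_eq, zero_mul, sub_zero]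
  exact not_le.1 fun h => hp4 ⟨hp3.1, h⟩

theorem A3_diff_A2_subset {u : ℝ} (hu : 0 < u) : A3 \ A2 ⊆ Cneg u := by
  rintro p ⟨hp3, hp2⟩
  have hx : p.1 < 0 := not_le.1 fun h => hp2 ⟨h, hp3.2⟩
  have he : 1 < Real.exp (-p.1) := Real.one_lt_exp_iff.2 (by linarith)
  have hy := hp3.2
  simp only [Cneg, mem_ofPred_eq]
  nlinarith

theorem measure_A1_inter_Cneg_eq_zero_iff (mu : Measure (ℝ × ℝ)) {u : ℝ} (hu : u ≤ 0) :
    mu (A1 ∩ Cneg u) = 0 ↔ theta1 mu ≤ (u : EReal) := by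
  constructor
  · intro h
    unfold theta1
    split_ifs
    · refine sSup_le ?_
      rintro _ ⟨v, ⟨-, hv⟩, rfl⟩
      refine EReal.coe_le_coe_iff.2 (not_lt.1 fun huv => hv.ne' ?_)
      exact measure_mono_null (A1_inter_Cneg_antitone huv.le) h
    · exact bot_le
  · intro h
    by_contra hne
    have hpos := pos_iff_ne_zero.2 hne
    rcases hu.eq_or_lt with rfl | hu
    · refine hne (measure_mono_null ?_ measure_empty)
      rintro p ⟨hpA, hp⟩
      simp only [Cneg, mem_ofPred_eq, zero_mul, sub_zero] at hp
      exact hp.not_ge hpA.2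
    · obtain ⟨w, -, hw, hlim⟩ := exists_seq_strictAnti_tendsto' hu
      obtain ⟨n, hn⟩ := exists_measure_inter_Cneg_pos hlim hpos
      rw [theta1, if_pos (hpos.trans_le (measure_mono A1_inter_Cneg_subset))] at h
      have hle := h.trans' (le_sSup ⟨w n, ⟨(hw n).2.le, hn⟩, rfl⟩)
      exact (hw n).1.not_ge (EReal.coe_le_coe_iff.1 hle)

theorem measure_A3_inter_Cneg_eq_zero_iff (mu : Measure (ℝ × ℝ)) {u : ℝ} (hu : u ≤ 0) :
    mu (A3 ∩ Cneg u) = 0 ↔ (u : EReal) ≤ theta3 mu := by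
  constructor
  · intro h
    unfold theta3
    split_ifs
    · refine le_sInf ?_
      rintro _ ⟨v, ⟨-, hv⟩, rfl⟩
      refine EReal.coe_le_coe_iff.2 (not_lt.1 fun huv => hv.ne' ?_)
      exact measure_mono_null (A3_inter_Cneg_monotone huv.le) h
    · exact_mod_cast hu
  · intro h
    by_contra hne
    have hpos := pos_iff_ne_zero.2 hne
    obtain ⟨w, -, hw, hlim⟩ := exists_seq_strictMono_tendsto u
    obtain ⟨n, hn⟩ := exists_measure_inter_Cneg_pos hlim hpos
    rw [theta3, if_pos (hpos.trans_le (measure_mono (A3_inter_Cneg_subset hu)))] at h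
    have hle := h.trans (sInf_le ⟨w n, ⟨(hw n).le.trans hu, hn⟩, rfl⟩)
    exact (hw n).not_ge (EReal.coe_le_coe_iff.1 hle)

theorem theta3_le_zero (mu : Measure (ℝ × ℝ)) : theta3 mu ≤ 0 := by
  unfold theta3
  split_ifs with h
  · exact sInf_le ⟨0, ⟨le_rfl, h.trans_le (measure_mono A3_diff_A4_subset)⟩, rfl⟩
  · exact le_rfl

theorem measure_Cneg_eq_zero_iff {mu : Measure (ℝ × ℝ)} (h2 : mu A2 = 0) {u : ℝ} (hu : u ≤ 0) :
    mu (Cneg u) = 0 ↔ mu (A1 ∩ Cneg u) = 0 ∧ mu (A3 ∩ Cneg u) = 0 := by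
  refine ⟨fun h => ⟨measure_mono_null inter_subset_right h,
    measure_mono_null inter_subset_right h⟩, fun ⟨h1, h3⟩ => ?_⟩
  refine measure_mono_null ?_ (measure_union_null (measure_union_null h1 h3) h2)
  intro p hp
  rcases le_total 0 p.1 with hx | hx <;> rcases le_total 0 p.2 with hy | hy
  · exact .inl (.inl ⟨⟨hx, hy⟩, hp⟩)
  · exact .inr ⟨hx, hy⟩
  · have h : p ∈ A4 ∩ Cneg u := ⟨⟨hx, hy⟩, hp⟩
    rw [A4_inter_Cneg_eq_empty hu] at h
    exact h.elim
  · exact .inl (.inr ⟨⟨hx, hy⟩, hp⟩)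

theorem Lstar_subset_Iic_zero {mu : Measure (ℝ × ℝ)} (h2 : mu A2 = 0) (h3 : 0 < mu A3) :
    Lstar mu ⊆ Set.Iic (0 : ℝ) := by
  intro u hu
  refine mem_Iic.2 (not_lt.1 fun hpos => h3.ne' ?_)
  rw [← measure_sdiff_null h2]
  exact measure_mono_null (A3_diff_A2_subset hpos) hu

theorem lstar_eq_interval_case_b (mu : Measure (ℝ × ℝ))
    (h2 : mu A2 = 0) (h3 : 0 < mu A3) (hth : theta1 mu ≤ theta3 mu) :
    Lstar mu = {u : ℝ | theta1 mu ≤ (u : EReal) ∧ (u : EReal) ≤ theta3 mu} ∧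
      Lstar mu ⊆ Set.Iic (0 : ℝ) := by
  have hsub := Lstar_subset_Iic_zero h2 h3
  have key {u : ℝ} (hu : u ≤ 0) :
      u ∈ Lstar mu ↔ theta1 mu ≤ (u : EReal) ∧ (u : EReal) ≤ theta3 mu := by
    rw [← measure_A1_inter_Cneg_eq_zero_iff mu hu, ← measure_A3_inter_Cneg_eq_zero_iff mu hu]
    exact measure_Cneg_eq_zero_iff h2 hu
  refine ⟨Subset.antisymm (fun u hu => (key (hsub hu)).1 hu) fun u hu => (key ?_).2 hu, hsub⟩
  exact_mod_cast hu.2.trans (theta3_le_zero mu)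

end
end

section
/- If L*(Π) = [b, ∞) for some b ∈ ℝ, then either U*(Π) = ∅ or U*(Π) = (−∞, a] for some real number a with a ≤ b. (Statement (3) of the proposition on the possible combinations of L* and U*.) -/
open MeasureTheory Set Filter

noncomputable section

theorem mem_Lstar_iff (mu : Measure (ℝ × ℝ)) (u : ℝ) :
    u ∈ Lstar mu ↔ ∀ᵐ p ∂mu, u * (Real.exp (-p.1) - 1) ≤ p.2 := by
  simp only [Lstar, Cneg, mem_ofPred_eq, ae_iff, not_le, sub_neg]

theorem mem_Ustar_iff (mu : Measure (ℝ × ℝ)) (u : ℝ) :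
    u ∈ Ustar mu ↔ ∀ᵐ p ∂mu, p.2 ≤ u * (Real.exp (-p.1) - 1) := by
  simp only [Ustar, Cpos, mem_ofPred_eq, ae_iff, not_le, sub_pos]

theorem isClosed_Ustar (mu : Measure (ℝ × ℝ)) : IsClosed (Ustar mu) := by
  refine IsSeqClosed.isClosed fun v a hv ha => ?_
  simp only [mem_Ustar_iff] at hv ⊢
  filter_upwards [ae_all_iff.2 hv] with p hp
  exact ge_of_tendsto' (ha.mul_const _) hp

/-- If `Lstar` contains a right half-line, then there are almost no jumps with `x < 0`. -/
theorem ae_exp_neg_sub_one_nonpos {mu : Measure (ℝ × ℝ)} {b : ℝ} (h : Ici b ⊆ Lstar mu) :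
    ∀ᵐ p ∂mu, Real.exp (-p.1) - 1 ≤ 0 := by
  have hn : ∀ n : ℕ, ∀ᵐ p ∂mu, (b + n) * (Real.exp (-p.1) - 1) ≤ p.2 := fun n =>
    (mem_Lstar_iff mu _).1 (h (by simp))
  filter_upwards [ae_all_iff.2 hn] with p hp
  by_contra! hpos
  obtain ⟨n, hlt⟩ := exists_nat_gt (p.2 / (Real.exp (-p.1) - 1) - b)
  have hlt' : p.2 / (Real.exp (-p.1) - 1) < b + n := by linarith
  exact (hp n).not_gt ((div_lt_iff₀ hpos).1 hlt')

theorem ustar_of_lstar_Ici (mu : Measure (ℝ × ℝ)) (b : ℝ)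
    (hL : Lstar mu = Set.Ici b) :
    Ustar mu = ∅ ∨ ∃ a : ℝ, a ≤ b ∧ Ustar mu = Set.Iic a := by
  have hg := ae_exp_neg_sub_one_nonpos hL.ge
  have hb : ∀ᵐ p ∂mu, b * (Real.exp (-p.1) - 1) ≤ p.2 :=
    (mem_Lstar_iff mu b).1 (hL.ge self_mem_Ici)
  have hle : ∀ u ∈ Ustar mu, u ≤ b := by
    intro u hu
    by_contra! hbu
    have hmem : b - 1 ∈ Lstar mu := by
      rw [mem_Lstar_iff]
      filter_upwards [hg, hb, (mem_Ustar_iff mu u).1 hu] with p h1 h2 h3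
      have h4 : Real.exp (-p.1) - 1 = 0 :=
        le_antisymm h1 (nonneg_of_mul_nonneg_right (by linarith) (sub_pos.2 hbu))
      simp only [h4, mul_zero] at h2 ⊢
      exact h2
    rw [hL, mem_Ici] at hmem
    linarith
  rcases (Ustar mu).eq_empty_or_nonempty with hempty | hne
  · exact Or.inl hempty
  have hbdd : BddAbove (Ustar mu) := ⟨b, hle⟩
  have hsup : sSup (Ustar mu) ∈ Ustar mu := (isClosed_Ustar mu).csSup_mem hne hbdd
  refine Or.inr ⟨sSup (Ustar mu), hle _ hsup, Subset.antisymm (fun u hu => le_csSup hbdd hu) ?_⟩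
  intro u hu
  rw [mem_Ustar_iff] at hsup ⊢
  filter_upwards [hg, hsup] with p h1 h2
  exact h2.trans (mul_le_mul_of_nonpos_right hu h1)

end
end
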